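/- Let Ξ_P: ẋ = A(x)w² + B(x)w + C(x) be a parabolic system on an open subset of ℝ² (A, B, C smooth vector fields, A(x), B(x) linearly independent at each point), with structure functions μ₀, μ₁, γ₀, γ₁ defined by [A,B] = μ₀A + μ₁B and C = γ₀A + γ₁B. Then Ξ_P is locally feedback equivalent at x₀ to a strongly-flat parabolic system ż = w² + c₀(x), ẏ = w (for some smooth function c₀) if and only if L_A(L_Aγ₁) + γ₁·(L_Aμ₁ − μ₁²) = (μ₀μ₁)/2 + (1/2)L_Aμ₀ + L_Bμ₁ on a neighbourhood of x₀. -/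

import Mathlib

noncomputable section

open Set

/-- Lie bracket `[A,B](x) = DB(x)A(x) − DA(x)B(x)` of vector fields on `ℝ²`. -/
def lieB (A B : (ℝ × ℝ) → ℝ × ℝ) : (ℝ × ℝ) → ℝ × ℝ :=
  fun x => fderiv ℝ B x (A x) - fderiv ℝ A x (B x)

/-- Lie derivative `L_A h = Dh·A` of a function along a vector field on `ℝ²`. -/
def lieD (A : (ℝ × ℝ) → ℝ × ℝ) (h : (ℝ × ℝ) → ℝ) : (ℝ × ℝ) → ℝ :=
  fun x => fderiv ℝ h x (A x)

/-- Local feedback equivalence at `p ↦ p'` of the control systems `ẋ = F(x,w)` and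
`ẋ' = F'(x',w')` on `ℝ²` (target defined on `V`). -/
def FbEquiv2 (F F' : (ℝ × ℝ) → ℝ → ℝ × ℝ) (p p' : ℝ × ℝ) (V : Set (ℝ × ℝ)) : Prop :=
  ∃ (φ : (ℝ × ℝ) → ℝ × ℝ) (ψ : (ℝ × ℝ) → ℝ → ℝ) (U₀ : Set (ℝ × ℝ)),
    IsOpen U₀ ∧ p ∈ U₀ ∧
    ContDiffOn ℝ (⊤ : ℕ∞) φ U₀ ∧ (∀ x ∈ U₀, Function.Bijective (fderiv ℝ φ x)) ∧
    φ p = p' ∧ (∀ x ∈ U₀, φ x ∈ V) ∧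
    ContDiffOn ℝ (⊤ : ℕ∞) (fun q : (ℝ × ℝ) × ℝ => ψ q.1 q.2) (U₀ ×ˢ univ) ∧
    (∀ x ∈ U₀, ∀ w' : ℝ, deriv (ψ x) w' ≠ 0) ∧
    (∀ x ∈ U₀, ∀ w' : ℝ, fderiv ℝ φ x (F x (ψ x w')) = F' (φ x) w')

lemma sm_diffAt {E F : Type*} [NormedAddCommGroup E] [NormedSpace ℝ E]
    [NormedAddCommGroup F] [NormedSpace ℝ F] {W : Set E} (hW : IsOpen W) {h : E → F}
    (hh : ContDiffOn ℝ (⊤ : ℕ∞) h W) {x : E} (hx : x ∈ W) : DifferentiableAt ℝ h x :=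
  (hh.contDiffAt (hW.mem_nhds hx)).differentiableAt (by simp)

lemma sm_lieD {W : Set (ℝ × ℝ)} (hW : IsOpen W) {A : ℝ × ℝ → ℝ × ℝ} {h : ℝ × ℝ → ℝ}
    (hA : ContDiffOn ℝ (⊤ : ℕ∞) A W) (hh : ContDiffOn ℝ (⊤ : ℕ∞) h W) : ContDiffOn ℝ (⊤ : ℕ∞) (lieD A h) W := by
  have := ((contDiffOn_infty_iff_fderiv_of_isOpen hW).1 hh).2
  exact this.clm_apply hA

lemma lieD_congr {W : Set (ℝ × ℝ)} (hW : IsOpen W) (A : ℝ × ℝ → ℝ × ℝ) {h k : ℝ × ℝ → ℝ}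
    (hk : ∀ x ∈ W, h x = k x) {x : ℝ × ℝ} (hx : x ∈ W) : lieD A h x = lieD A k x := by
  have : h =ᶠ[nhds x] k := Filter.eventually_of_mem (hW.mem_nhds hx) hk
  simp only [lieD, this.fderiv_eq]

lemma lieD_mul {A : ℝ × ℝ → ℝ × ℝ} {h k : ℝ × ℝ → ℝ} {x : ℝ × ℝ}
    (hh : DifferentiableAt ℝ h x) (hk : DifferentiableAt ℝ k x) :
    lieD A (fun y => h y * k y) x = lieD A h x * k x + h x * lieD A k x := by
  simp only [lieD]
  rw [fderiv_fun_mul hh hk]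
  simp
  ring

lemma lieD_add {A : ℝ × ℝ → ℝ × ℝ} {h k : ℝ × ℝ → ℝ} {x : ℝ × ℝ}
    (hh : DifferentiableAt ℝ h x) (hk : DifferentiableAt ℝ k x) :
    lieD A (fun y => h y + k y) x = lieD A h x + lieD A k x := by
  simp only [lieD]
  rw [fderiv_fun_add hh hk]
  simp

lemma lieD_cmul {A : ℝ × ℝ → ℝ × ℝ} {h : ℝ × ℝ → ℝ} {x : ℝ × ℝ} (c : ℝ)
    (hh : DifferentiableAt ℝ h x) :
    lieD A (fun y => c * h y) x = c * lieD A h x := by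
  simp only [lieD]
  rw [fderiv_const_mul hh]
  simp

lemma lieD_zero (A : ℝ × ℝ → ℝ × ℝ) (x : ℝ × ℝ) :
    lieD A (fun _ => (0 : ℝ)) x = 0 := by
  simp [lieD]

lemma lieD_exp {A : ℝ × ℝ → ℝ × ℝ} {h : ℝ × ℝ → ℝ} {x : ℝ × ℝ}
    (hh : DifferentiableAt ℝ h x) :
    lieD A (fun y => Real.exp (h y)) x = Real.exp (h x) * lieD A h x := by
  simp only [lieD]
  rw [fderiv_exp hh]
  simp

lemma lieD_comm {W : Set (ℝ × ℝ)} (hW : IsOpen W) {A B : ℝ × ℝ → ℝ × ℝ} {h μ₀ μ₁ : ℝ × ℝ → ℝ}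
    (hA : ContDiffOn ℝ (⊤ : ℕ∞) A W) (hB : ContDiffOn ℝ (⊤ : ℕ∞) B W) (hh : ContDiffOn ℝ (⊤ : ℕ∞) h W)
    (hμ : ∀ x ∈ W, lieB A B x = μ₀ x • A x + μ₁ x • B x) {x : ℝ × ℝ} (hx : x ∈ W) :
    lieD A (lieD B h) x - lieD B (lieD A h) x = μ₀ x * lieD A h x + μ₁ x * lieD B h x := by
  have h1 := VectorField.fderiv_apply_lieBracket (𝕜 := ℝ) (V := A) (W := B) (n := 2)
    ((hh.contDiffAt (hW.mem_nhds hx)).of_le (by exact WithTop.coe_le_coe.2 le_top)) (by simp)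
    (sm_diffAt hW hB hx) (sm_diffAt hW hA hx)
  have h2 : VectorField.lieBracket ℝ A B x = μ₀ x • A x + μ₁ x • B x := hμ x hx
  rw [h2] at h1
  simp only [map_add, map_smul, smul_eq_mul] at h1
  exact h1.symm

lemma det_ne {a b : ℝ × ℝ} (h : LinearIndependent ℝ ![a, b]) : a.1 * b.2 - a.2 * b.1 ≠ 0 := by
  intro h0
  rw [LinearIndependent.pair_iff] at h
  by_cases hb : b.1 = 0 ∧ b.2 = 0
  · have := h 0 1 (by ext <;> simp [hb.1, hb.2])
    simp at this
  · have e1 := h b.2 (-a.2) (by ext <;> simp <;> linarith)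
    have e2 := h b.1 (-a.1) (by ext <;> simp <;> linarith)
    exact hb ⟨e2.1, e1.1⟩

lemma frame_decomp {a b : ℝ × ℝ} (h : a.1 * b.2 - a.2 * b.1 ≠ 0) (v : ℝ × ℝ) :
    ∃ s t : ℝ, v = s • a + t • b := by
  refine ⟨(v.1 * b.2 - v.2 * b.1) / (a.1 * b.2 - a.2 * b.1),
    (a.1 * v.2 - a.2 * v.1) / (a.1 * b.2 - a.2 * b.1), ?_⟩
  ext
  · simp only [Prod.fst_add, Prod.smul_fst, smul_eq_mul]
    rw [div_mul_eq_mul_div, div_mul_eq_mul_div, ← add_div, eq_div_iff h]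
    ring
  · simp only [Prod.snd_add, Prod.smul_snd, smul_eq_mul]
    rw [div_mul_eq_mul_div, div_mul_eq_mul_div, ← add_div, eq_div_iff h]
    ring

lemma frame_poincare {W : Set (ℝ × ℝ)} (hW : IsOpen W) (hc : Convex ℝ W)
    {A B : ℝ × ℝ → ℝ × ℝ} {p q μ₀ μ₁ : ℝ × ℝ → ℝ}
    (hA : ContDiffOn ℝ (⊤ : ℕ∞) A W) (hB : ContDiffOn ℝ (⊤ : ℕ∞) B W) (hp : ContDiffOn ℝ (⊤ : ℕ∞) p W) (hq : ContDiffOn ℝ (⊤ : ℕ∞) q W)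
    (hd : ∀ x ∈ W, (A x).1 * (B x).2 - (A x).2 * (B x).1 ≠ 0)
    (hμ : ∀ x ∈ W, lieB A B x = μ₀ x • A x + μ₁ x • B x)
    (hpq : ∀ x ∈ W, lieD A q x - lieD B p x = μ₀ x * p x + μ₁ x * q x) :
    ∃ h : ℝ × ℝ → ℝ, ContDiffOn ℝ (⊤ : ℕ∞) h W ∧ ∀ x ∈ W, lieD A h x = p x ∧ lieD B h x = q x := by
  set ω : ℝ × ℝ → (ℝ × ℝ →L[ℝ] ℝ) := fun x =>
    ((p x * (B x).2 - q x * (A x).2) / ((A x).1 * (B x).2 - (A x).2 * (B x).1)) •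
        ContinuousLinearMap.fst ℝ ℝ ℝ
      + (((A x).1 * q x - (B x).1 * p x) / ((A x).1 * (B x).2 - (A x).2 * (B x).1)) •
        ContinuousLinearMap.snd ℝ ℝ ℝ with hω
  have hA1 : ContDiffOn ℝ (⊤ : ℕ∞) (fun x => (A x).1) W := hA.fst
  have hA2 : ContDiffOn ℝ (⊤ : ℕ∞) (fun x => (A x).2) W := hA.snd
  have hB1 : ContDiffOn ℝ (⊤ : ℕ∞) (fun x => (B x).1) W := hB.fst
  have hB2 : ContDiffOn ℝ (⊤ : ℕ∞) (fun x => (B x).2) W := hB.snd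
  have hωs : ContDiffOn ℝ (⊤ : ℕ∞) ω W := by
    apply ContDiffOn.add
    · exact ContDiffOn.smul (((hp.mul hB2).sub (hq.mul hA2)).div
        ((hA1.mul hB2).sub (hA2.mul hB1)) hd) contDiffOn_const
    · exact ContDiffOn.smul (((hA1.mul hq).sub (hB1.mul hp)).div
        ((hA1.mul hB2).sub (hA2.mul hB1)) hd) contDiffOn_const
  have hωA : ∀ x ∈ W, ω x (A x) = p x := by
    intro x hx
    have := hd x hx
    simp only [hω, add_apply, smul_apply,
      ContinuousLinearMap.coe_fst', ContinuousLinearMap.coe_snd', smul_eq_mul]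
    rw [div_mul_eq_mul_div, div_mul_eq_mul_div, ← add_div, div_eq_iff this]
    ring
  have hωB : ∀ x ∈ W, ω x (B x) = q x := by
    intro x hx
    have := hd x hx
    simp only [hω, add_apply, smul_apply,
      ContinuousLinearMap.coe_fst', ContinuousLinearMap.coe_snd', smul_eq_mul]
    rw [div_mul_eq_mul_div, div_mul_eq_mul_div, ← add_div, div_eq_iff this]
    ring
  have key : ∀ (X : ℝ × ℝ → ℝ × ℝ) (r : ℝ × ℝ → ℝ), ContDiffOn ℝ (⊤ : ℕ∞) X W → (∀ x ∈ W, ω x (X x) = r x) →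
      ∀ x ∈ W, ∀ v, fderiv ℝ ω x v (X x) + ω x (fderiv ℝ X x v) = fderiv ℝ r x v := by
    intro X r hX hr x hx v
    have e : (fun y => ω y (X y)) =ᶠ[nhds x] r := Filter.eventually_of_mem (hW.mem_nhds hx) hr
    rw [← e.fderiv_eq, fderiv_clm_apply (sm_diffAt hW hωs hx) (sm_diffAt hW hX hx)]
    simp [add_comm]
  have hsymm : ∀ a ∈ W, ∀ x y, fderiv ℝ ω a x y = fderiv ℝ ω a y x := by
    intro a ha x y
    have k1 := key B q hB hωB a ha (A a)
    have k2 := key A p hA hωA a ha (B a)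
    have k3 := hpq a ha
    have k4 : ω a (lieB A B a) = μ₀ a * p a + μ₁ a * q a := by
      rw [hμ a ha]; simp only [map_add, map_smul, smul_eq_mul, hωA a ha, hωB a ha]
    simp only [lieB, map_sub] at k4
    simp only [lieD] at k3
    have k5 : fderiv ℝ ω a (A a) (B a) = fderiv ℝ ω a (B a) (A a) := by linarith
    obtain ⟨s, t, rfl⟩ := frame_decomp (hd a ha) x
    obtain ⟨s', t', rfl⟩ := frame_decomp (hd a ha) y
    simp only [map_add, map_smul, add_apply, smul_apply,
      smul_eq_mul, k5]
    ring
  obtain ⟨h, hh⟩ := hc.exists_forall_hasFDerivAt_of_fderiv_symmetric hW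
    (fun x hx => (sm_diffAt hW hωs hx).differentiableWithinAt) hsymm
  refine ⟨h, ?_, fun x hx => ⟨?_, ?_⟩⟩
  · refine (contDiffOn_infty_iff_fderiv_of_isOpen hW).2
      ⟨fun x hx => (hh x hx).differentiableAt.differentiableWithinAt, ?_⟩
    exact hωs.congr fun x hx => (hh x hx).fderiv
  · rw [lieD, (hh x hx).fderiv, hωA x hx]
  · rw [lieD, (hh x hx).fderiv, hωB x hx]

lemma lieD_s {W : Set (ℝ × ℝ)} (hW : IsOpen W) {A : ℝ × ℝ → ℝ × ℝ} {μ₀ μ₁ γ₁ : ℝ × ℝ → ℝ}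
    (hA : ContDiffOn ℝ (⊤ : ℕ∞) A W) (hμ₀ : ContDiffOn ℝ (⊤ : ℕ∞) μ₀ W) (hμ₁ : ContDiffOn ℝ (⊤ : ℕ∞) μ₁ W) (hγ₁ : ContDiffOn ℝ (⊤ : ℕ∞) γ₁ W) {x : ℝ × ℝ} (hx : x ∈ W) :
    lieD A (fun y => (lieD A γ₁ y + γ₁ y * μ₁ y) + (-1 / 2) * μ₀ y) x =
      lieD A (lieD A γ₁) x + (lieD A γ₁ x * μ₁ x + γ₁ x * lieD A μ₁ x) - 1 / 2 * lieD A μ₀ x := by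
  have d1 := sm_diffAt hW (sm_lieD hW hA hγ₁) hx
  have d2 := sm_diffAt hW hγ₁ hx
  have d3 := sm_diffAt hW hμ₁ hx
  have d4 := sm_diffAt hW hμ₀ hx
  rw [lieD_add (h := fun y => lieD A γ₁ y + γ₁ y * μ₁ y) (k := fun y => (-1 / 2) * μ₀ y)
    (by fun_prop) (by fun_prop), lieD_add (h := fun y => lieD A γ₁ y)
    (k := fun y => γ₁ y * μ₁ y) (by fun_prop) (by fun_prop), lieD_mul d2 d3, lieD_cmul _ d4]
  ring

/-- Pointwise algebra: quadratic in the feedback must have vanishing leading coefficient. -/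
lemma pointwise_quad {ψ : ℝ → ℝ} {a b c a' b' c' k : ℝ}
    (h2 : ∀ w, a * ψ w ^ 2 + b * ψ w + c = w)
    (h1 : ∀ w, a' * ψ w ^ 2 + b' * ψ w + c' = w ^ 2 + k) :
    a = 0 ∧ b ≠ 0 ∧ a' = b ^ 2 ∧ b' = 2 * b * c := by
  have ha : a = 0 := by
    by_contra ha
    have hsq : ∀ w, 4 * a * w = (2 * a * ψ w + b) ^ 2 + 4 * a * c - b ^ 2 := by
      intro w
      linear_combination (-4 * a) * h2 w
    have h3 := hsq ((4 * a * c - b ^ 2 - 1) / (4 * a))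
    have h4 : 4 * a * ((4 * a * c - b ^ 2 - 1) / (4 * a)) = 4 * a * c - b ^ 2 - 1 := by
      field_simp
    nlinarith [sq_nonneg (2 * a * ψ ((4 * a * c - b ^ 2 - 1) / (4 * a)) + b)]
  subst ha
  have hb : b ≠ 0 := by
    rintro rfl
    have e0 := h2 0
    have e1 := h2 1
    simp at e0 e1
    linarith
  have hψe : ∀ v, ψ (b * v + c) = v := by
    intro v
    have := h2 (b * v + c)
    have h5 : b * (ψ (b * v + c) - v) = 0 := by linear_combination this
    rcases mul_eq_zero.1 h5 with h | h
    · exact absurd h hb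
    · linarith
  have g : ∀ v, a' * v ^ 2 + b' * v + c' = (b * v + c) ^ 2 + k := by
    intro v
    have := h1 (b * v + c)
    rwa [hψe] at this
  have g0 := g 0
  have g1 := g 1
  have g2 := g (-1)
  exact ⟨rfl, hb, by linarith, by linarith⟩

/-- a parabolic system `ẋ = A(x)w² + B(x)w + C(x)` with structure functions
`[A,B] = μ₀A + μ₁B`, `C = γ₀A + γ₁B`, is locally feedback equivalent at `x₀` to a
strongly-flat parabolic system `ż = w² + c₀(x), ẏ = w` (for some smooth `c₀`) iff
`L_A(L_Aγ₁) + γ₁(L_Aμ₁ − μ₁²) = μ₀μ₁/2 + (1/2)L_Aμ₀ + L_Bμ₁` near `x₀`. -/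
theorem stmt_19 (U : Set (ℝ × ℝ)) (hU : IsOpen U) (x₀ : ℝ × ℝ) (hx₀ : x₀ ∈ U)
    (A B C : (ℝ × ℝ) → ℝ × ℝ)
    (hA : ContDiffOn ℝ (⊤ : ℕ∞) A U) (hB : ContDiffOn ℝ (⊤ : ℕ∞) B U) (hC : ContDiffOn ℝ (⊤ : ℕ∞) C U)
    (hAB : ∀ x ∈ U, LinearIndependent ℝ ![A x, B x])
    (μ₀ μ₁ γ₀ γ₁ : (ℝ × ℝ) → ℝ)
    (hμ₀ : ContDiffOn ℝ (⊤ : ℕ∞) μ₀ U) (hμ₁ : ContDiffOn ℝ (⊤ : ℕ∞) μ₁ U)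
    (hγ₀ : ContDiffOn ℝ (⊤ : ℕ∞) γ₀ U) (hγ₁ : ContDiffOn ℝ (⊤ : ℕ∞) γ₁ U)
    (hμ : ∀ x ∈ U, lieB A B x = μ₀ x • A x + μ₁ x • B x)
    (hγ : ∀ x ∈ U, C x = γ₀ x • A x + γ₁ x • B x) :
    (∃ (c₀ : (ℝ × ℝ) → ℝ) (V : Set (ℝ × ℝ)) (p' : ℝ × ℝ),
      IsOpen V ∧ p' ∈ V ∧ ContDiffOn ℝ (⊤ : ℕ∞) c₀ V ∧
      FbEquiv2 (fun x w => w ^ 2 • A x + w • B x + C x)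
        (fun x w => (w ^ 2 + c₀ x, w)) x₀ p' V)
    ↔
    (∃ U₀ : Set (ℝ × ℝ), IsOpen U₀ ∧ x₀ ∈ U₀ ∧ U₀ ⊆ U ∧
      ∀ x ∈ U₀,
        lieD A (lieD A γ₁) x + γ₁ x * (lieD A μ₁ x - (μ₁ x) ^ 2)
          = (μ₀ x * μ₁ x) / 2 + (1 / 2) * lieD A μ₀ x + lieD B μ₁ x) := by
  have hdet : ∀ x ∈ U, (A x).1 * (B x).2 - (A x).2 * (B x).1 ≠ 0 :=
    fun x hx => det_ne (hAB x hx)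
  constructor
  · rintro ⟨c₀, V, p', -, -, -, φ, ψ, U₁, hU₁, hxU₁, hφ, -, -, -, -, -, heq⟩
    have hW : IsOpen (U₁ ∩ U) := hU₁.inter hU
    refine ⟨U₁ ∩ U, hW, ⟨hxU₁, hx₀⟩, inter_subset_right, ?_⟩
    replace hA := hA.mono (inter_subset_right : U₁ ∩ U ⊆ U)
    replace hB := hB.mono (inter_subset_right : U₁ ∩ U ⊆ U)
    replace hμ₀ := hμ₀.mono (inter_subset_right : U₁ ∩ U ⊆ U)
    replace hμ₁ := hμ₁.mono (inter_subset_right : U₁ ∩ U ⊆ U)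
    replace hγ₁ := hγ₁.mono (inter_subset_right : U₁ ∩ U ⊆ U)
    replace hφ := hφ.mono (inter_subset_left : U₁ ∩ U ⊆ U₁)
    replace hμ : ∀ x ∈ U₁ ∩ U, lieB A B x = μ₀ x • A x + μ₁ x • B x := fun x hx => hμ x hx.2
    set f : ℝ × ℝ → ℝ := fun x => (φ x).2 with hf
    set g : ℝ × ℝ → ℝ := fun x => (φ x).1 with hg
    have hfs : ContDiffOn ℝ (⊤ : ℕ∞) f (U₁ ∩ U) := hφ.snd
    have hgs : ContDiffOn ℝ (⊤ : ℕ∞) g (U₁ ∩ U) := hφ.fst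
    set b := lieD B f with hb
    have hbs : ContDiffOn ℝ (⊤ : ℕ∞) b (U₁ ∩ U) := sm_lieD hW hB hfs
    have pt : ∀ x ∈ U₁ ∩ U, lieD A f x = 0 ∧ b x ≠ 0 ∧ lieD A g x = b x * b x ∧
        lieD B g x = 2 * (γ₁ x * (b x * b x)) := by
      intro x hx
      have hd := sm_diffAt hW hφ hx
      have e1 : ∀ v, (fderiv ℝ φ x v).1 = fderiv ℝ g x v := by
        intro v; rw [hd.hasFDerivAt.fst.fderiv]; rfl
      have e2 : ∀ v, (fderiv ℝ φ x v).2 = fderiv ℝ f x v := by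
        intro v; rw [hd.hasFDerivAt.snd.fderiv]; rfl
      have h := heq x hx.1
      have q := pointwise_quad (ψ := ψ x) (a := lieD A f x) (b := lieD B f x)
        (c := fderiv ℝ f x (C x)) (a' := lieD A g x) (b' := lieD B g x)
        (c' := fderiv ℝ g x (C x)) (k := c₀ (φ x))
        (fun w => by
          have := congrArg Prod.snd (h w)
          rw [e2] at this
          simp only [map_add, map_smul, smul_eq_mul] at this
          simp only [lieD]
          linarith)
        (fun w => by
          have := congrArg Prod.fst (h w)
          rw [e1] at this
          simp only [map_add, map_smul, smul_eq_mul] at this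
          simp only [lieD]
          linarith)
      obtain ⟨q1, q2, q3, q4⟩ := q
      refine ⟨q1, q2, by rw [q3, hb]; ring, ?_⟩
      rw [hγ x hx.2] at q4
      simp only [map_add, map_smul, smul_eq_mul] at q4
      have q1' : fderiv ℝ f x (A x) = 0 := q1
      rw [q4, q1']
      simp only [hb, lieD]
      ring
    have hbA : ∀ x ∈ U₁ ∩ U, lieD A b x = μ₁ x * b x := by
      intro x hx
      have c := lieD_comm hW hA hB hfs hμ hx
      rw [lieD_congr hW B (fun y hy => (pt y hy).1) hx, lieD_zero, (pt x hx).1] at c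
      linarith
    have hbB : ∀ x ∈ U₁ ∩ U,
        lieD B b x = b x * ((lieD A γ₁ x + γ₁ x * μ₁ x) + (-1 / 2) * μ₀ x) := by
      intro x hx
      have c := lieD_comm hW hA hB hgs hμ hx
      have d1 := sm_diffAt hW hbs hx
      have d2 := sm_diffAt hW hγ₁ hx
      rw [lieD_congr hW B (fun y hy => (pt y hy).2.2.1) hx,
        lieD_congr hW A (fun y hy => (pt y hy).2.2.2) hx, (pt x hx).2.2.1, (pt x hx).2.2.2,
        lieD_mul d1 d1, lieD_cmul (h := fun y => γ₁ y * (b y * b y)) _ (by fun_prop),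
        lieD_mul (k := fun y => b y * b y) d2 (by fun_prop), lieD_mul d1 d1, hbA x hx] at c
      apply mul_left_cancel₀ (pt x hx).2.1
      linear_combination (-1 / 2) * c
    intro x hx
    have c := lieD_comm hW hA hB hbs hμ hx
    have d1 := sm_diffAt hW hbs hx
    have d2 := sm_diffAt hW hγ₁ hx
    have d3 := sm_diffAt hW hμ₁ hx
    have d4 := sm_diffAt hW hμ₀ hx
    have d5 := sm_diffAt hW (sm_lieD hW hA hγ₁) hx
    rw [lieD_congr hW B hbA hx, lieD_congr hW A hbB hx,
      lieD_mul (k := fun y => (lieD A γ₁ y + γ₁ y * μ₁ y) + (-1 / 2) * μ₀ y) d1 (by fun_prop),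
      lieD_s hW hA hμ₀ hμ₁ hγ₁ hx, lieD_mul d3 d1, hbA x hx, hbB x hx] at c
    apply mul_left_cancel₀ (pt x hx).2.1
    linear_combination c
  · rintro ⟨U₁, hU₁, hxU₁, hU₁U, hcond⟩
    obtain ⟨r, hr, hball⟩ := Metric.isOpen_iff.1 hU₁ x₀ hxU₁
    set W := Metric.ball x₀ r with hWdef
    have hW : IsOpen W := Metric.isOpen_ball
    have hWc : Convex ℝ W := convex_ball x₀ r
    have hxW : x₀ ∈ W := Metric.mem_ball_self hr
    have hWU : W ⊆ U := hball.trans hU₁U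
    replace hcond := fun x (hx : x ∈ W) => hcond x (hball hx)
    replace hA := hA.mono hWU
    replace hB := hB.mono hWU
    replace hμ₀ := hμ₀.mono hWU
    replace hμ₁ := hμ₁.mono hWU
    replace hγ₀ := hγ₀.mono hWU
    replace hγ₁ := hγ₁.mono hWU
    replace hμ : ∀ x ∈ W, lieB A B x = μ₀ x • A x + μ₁ x • B x := fun x hx => hμ x (hWU hx)
    replace hγ : ∀ x ∈ W, C x = γ₀ x • A x + γ₁ x • B x := fun x hx => hγ x (hWU hx)
    replace hdet : ∀ x ∈ W, (A x).1 * (B x).2 - (A x).2 * (B x).1 ≠ 0 :=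
      fun x hx => hdet x (hWU hx)
    -- the logarithm of the scaling factor
    obtain ⟨β, hβ, hβAB⟩ := frame_poincare hW hWc hA hB (p := μ₁)
      (q := fun y => (lieD A γ₁ y + γ₁ y * μ₁ y) + (-1 / 2) * μ₀ y) hμ₁
      (((sm_lieD hW hA hγ₁).add (hγ₁.mul hμ₁)).add (contDiffOn_const.mul hμ₀)) hdet hμ
      (fun x hx => by
        rw [lieD_s hW hA hμ₀ hμ₁ hγ₁ hx]
        linear_combination hcond x hx)
    set b : ℝ × ℝ → ℝ := fun y => Real.exp (β y) with hb
    have hbs : ContDiffOn ℝ (⊤ : ℕ∞) b W := hβ.exp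
    have hb0 : ∀ x, b x ≠ 0 := fun x => (Real.exp_pos _).ne'
    have hbA : ∀ x ∈ W, lieD A b x = b x * μ₁ x := by
      intro x hx
      rw [hb, lieD_exp (sm_diffAt hW hβ hx), (hβAB x hx).1]
    have hbB : ∀ x ∈ W,
        lieD B b x = b x * ((lieD A γ₁ x + γ₁ x * μ₁ x) + (-1 / 2) * μ₀ x) := by
      intro x hx
      rw [hb, lieD_exp (sm_diffAt hW hβ hx), (hβAB x hx).2]
    obtain ⟨f, hf, hfAB⟩ := frame_poincare hW hWc hA hB (p := fun _ => 0) (q := b)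
      contDiffOn_const hbs hdet hμ (fun x hx => by
        rw [lieD_zero, hbA x hx]; ring)
    obtain ⟨g, hg, hgAB⟩ := frame_poincare hW hWc hA hB (p := fun y => b y * b y)
      (q := fun y => 2 * (γ₁ y * (b y * b y))) (hbs.mul hbs)
      (contDiffOn_const.mul (hγ₁.mul (hbs.mul hbs))) hdet hμ (fun x hx => by
        have d1 := sm_diffAt hW hbs hx
        have d2 := sm_diffAt hW hγ₁ hx
        rw [lieD_mul d1 d1, lieD_cmul (h := fun y => γ₁ y * (b y * b y)) _ (by fun_prop),
          lieD_mul (k := fun y => b y * b y) d2 (by fun_prop), lieD_mul d1 d1, hbA x hx, hbB x hx]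
        ring)
    set φ : ℝ × ℝ → ℝ × ℝ := fun x => (g x, f x) with hφdef
    have hφ : ContDiffOn ℝ (⊤ : ℕ∞) φ W := hg.prodMk hf
    have hφd : ∀ x ∈ W, ∀ v, fderiv ℝ φ x v = (fderiv ℝ g x v, fderiv ℝ f x v) := by
      intro x hx v
      rw [((sm_diffAt hW hg hx).hasFDerivAt.prodMk (sm_diffAt hW hf hx).hasFDerivAt).fderiv]
      rfl
    have hφA : ∀ x ∈ W, fderiv ℝ φ x (A x) = (b x * b x, 0) := by
      intro x hx
      rw [hφd x hx, ← (hgAB x hx).1, ← (hfAB x hx).1]; rfl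
    have hφB : ∀ x ∈ W, fderiv ℝ φ x (B x) = (2 * (γ₁ x * (b x * b x)), b x) := by
      intro x hx
      rw [hφd x hx, ← (hgAB x hx).2, ← (hfAB x hx).2]; rfl
    have hinj : ∀ x ∈ W, Function.Injective (fderiv ℝ φ x) := by
      intro x hx
      rw [injective_iff_map_eq_zero]
      intro v hv
      obtain ⟨s, t, rfl⟩ := frame_decomp (hdet x hx) v
      rw [map_add, map_smul, map_smul, hφA x hx, hφB x hx] at hv
      have h1 := congrArg Prod.fst hv
      have h2 := congrArg Prod.snd hv
      simp [hb0 x] at h1 h2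
      subst h2
      simp [hb0 x] at h1
      simp [h1]
    have hbij : ∀ x ∈ W, Function.Bijective (fderiv ℝ φ x) := fun x hx =>
      ⟨hinj x hx, LinearMap.surjective_of_injective (f := (fderiv ℝ φ x).toLinearMap) (hinj x hx)⟩
    let D : ∀ x ∈ W, ((ℝ × ℝ) ≃L[ℝ] (ℝ × ℝ)) := fun x hx =>
      (LinearEquiv.ofBijective (fderiv ℝ φ x).toLinearMap (hbij x hx)).toContinuousLinearEquiv
    have hD : ∀ x (hx : x ∈ W), HasFDerivAt φ ((D x hx : (ℝ × ℝ) →L[ℝ] (ℝ × ℝ))) x := by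
      intro x hx
      have : ((D x hx : (ℝ × ℝ) →L[ℝ] (ℝ × ℝ))) = fderiv ℝ φ x := by
        ext v <;> rfl
      rw [this]
      exact (sm_diffAt hW hφ hx).hasFDerivAt
    have hφat : ∀ x ∈ W, ContDiffAt ℝ (⊤ : ℕ∞) φ x := fun x hx => hφ.contDiffAt (hW.mem_nhds hx)
    let e := (hφat x₀ hxW).toOpenPartialHomeomorph φ (hD x₀ hxW) (by simp)
    have he : ∀ x, e x = φ x := fun x => rfl
    have hxe : x₀ ∈ e.source :=
      (hφat x₀ hxW).mem_toOpenPartialHomeomorph_source (hD x₀ hxW) (by simp)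
    set V : Set (ℝ × ℝ) := e.target ∩ e.symm ⁻¹' W with hV
    have hVo : IsOpen V := e.isOpen_inter_preimage_symm hW
    have hVmem : ∀ x ∈ W ∩ e.source, φ x ∈ V := by
      intro x hx
      refine ⟨e.map_source hx.2, ?_⟩
      change e.symm (e x) ∈ W
      rw [e.left_inv hx.2]; exact hx.1
    have hsymm : ContDiffOn ℝ (⊤ : ℕ∞) e.symm V := by
      intro y hy
      exact (e.contDiffAt_symm hy.1 (hD _ hy.2) (hφat _ hy.2)).contDiffWithinAt
    refine ⟨fun y => (γ₀ (e.symm y) + γ₁ (e.symm y) * γ₁ (e.symm y)) *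
        (b (e.symm y) * b (e.symm y)), V, φ x₀, hVo, hVmem x₀ ⟨hxW, hxe⟩, ?_, φ,
        fun x w => w / b x - γ₁ x, W ∩ e.source, hW.inter e.open_source, ⟨hxW, hxe⟩,
        hφ.mono inter_subset_left, fun x hx => hbij x hx.1, rfl, hVmem, ?_, ?_, ?_⟩
    · have hk : ContDiffOn ℝ (⊤ : ℕ∞) (fun x => (γ₀ x + γ₁ x * γ₁ x) * (b x * b x)) W :=
        (hγ₀.add (hγ₁.mul hγ₁)).mul (hbs.mul hbs)
      exact hk.comp hsymm (fun y hy => hy.2)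
    · have hm : MapsTo (Prod.fst : (ℝ × ℝ) × ℝ → ℝ × ℝ) ((W ∩ e.source) ×ˢ univ) W :=
        fun q hq => hq.1.1
      have h1 : ContDiffOn ℝ (⊤ : ℕ∞) (fun q : (ℝ × ℝ) × ℝ => b q.1)
          ((W ∩ e.source) ×ˢ univ) := hbs.comp contDiffOn_fst hm
      have h2 : ContDiffOn ℝ (⊤ : ℕ∞) (fun q : (ℝ × ℝ) × ℝ => γ₁ q.1)
          ((W ∩ e.source) ×ˢ univ) := hγ₁.comp contDiffOn_fst hm
      exact (contDiffOn_snd.div h1 (fun q _ => hb0 q.1)).sub h2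
    · intro x hx w'
      have : HasDerivAt (fun w => w / b x - γ₁ x) (1 / b x) w' :=
        ((hasDerivAt_id w').div_const (b x)).sub_const (γ₁ x)
      rw [this.deriv]
      exact one_div_ne_zero (hb0 x)
    · intro x hx w'
      have hes : e.symm (φ x) = x := e.left_inv hx.2
      have hbx := hb0 x
      simp only [hes]
      rw [hγ x hx.1]
      simp only [map_add, map_smul, hφA x hx.1, hφB x hx.1]
      ext
      · simp
        field_simp
        ring
      · simp
        field_simp
        ring
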